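/- arXiv:1610.00145 — 2 statements merged into one kernel-verified Lean document; each statement's English description precedes it below -/
import Mathlib

section
/- Let X be a Polish path-connected space, x ∈ X, and G ≤ π₁(X,x) an analytic subgroup (i.e., the set of loops representing elements of G is an analytic subset of the loop space L_x). Then the index of G in π₁(X,x) is either at most ℵ₁ or equal to 2^{ℵ₀}. -/
open FundamentalGroup

attribute [local instance] Path.Homotopic.setoid

/-- The set of loops at `x` representing elements of the subgroup `G` of `π₁(X, x)`. -/
def loopsIn {X : Type} [TopologicalSpace X] {x : X} (G : Subgroup (FundamentalGroup X x)) :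
    Set (Path x x) :=
  {p : Path x x |
    FundamentalGroup.fromPath (X := TopCat.of X) (⟦p⟧ : Path.Homotopic.Quotient x x) ∈ G}

namespace Burgess
open Set Filter Topology

theorem exists_cyl {α : Type*} [TopologicalSpace α] [DiscreteTopology α] {b : ℕ → α}
    {s : Set (ℕ → α)} (hs : s ∈ 𝓝 b) : ∃ n, ∀ c : ℕ → α, (∀ i < n, c i = b i) → c ∈ s := by
  obtain ⟨V, hV, hbV, hVs⟩ :=
    (PiNat.isTopologicalBasis_cylinders (fun _ : ℕ => α)).mem_nhds_iff.1 hs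
  obtain ⟨x, n, rfl⟩ := hV
  refine ⟨n, fun c hc => hVs ?_⟩
  rw [PiNat.mem_cylinder_iff] at hbV ⊢
  intro i hi
  rw [hc i hi, hbV i hi]

theorem cyl_mem_nhds {α : Type*} [TopologicalSpace α] [DiscreteTopology α] (b : ℕ → α)
    (n : ℕ) : {c : ℕ → α | ∀ i < n, c i = b i} ∈ 𝓝 b := by
  have := (PiNat.isOpen_cylinder (fun _ : ℕ => α) b n).mem_nhds (PiNat.self_mem_cylinder b n)
  exact this

theorem exists_cyl₂ {α : Type*} [TopologicalSpace α] [DiscreteTopology α] {b b' : ℕ → α}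
    {s : Set ((ℕ → α) × (ℕ → α))} (hs : s ∈ 𝓝 (b, b')) :
    ∃ n, ∀ c c' : ℕ → α, (∀ i < n, c i = b i) → (∀ i < n, c' i = b' i) → (c, c') ∈ s := by
  rw [nhds_prod_eq, mem_prod_iff] at hs
  obtain ⟨u, hu, v, hv, huv⟩ := hs
  obtain ⟨n, hn⟩ := exists_cyl hu
  obtain ⟨m, hm⟩ := exists_cyl hv
  exact ⟨max n m, fun c c' h h' => huv ⟨hn c fun i hi => h i (lt_of_lt_of_le hi (le_max_left _ _)),
    hm c' fun i hi => h' i (lt_of_lt_of_le hi (le_max_right _ _))⟩⟩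

/-- The part of the range of `f` coming from sequences with initial segment `t`. -/
def piece {Z : Type*} (f : (ℕ → ℕ) → Z) (t : List ℕ) : Set Z :=
  f '' {b | PiNat.res b t.length = t}

theorem piece_nil {Z : Type*} (f : (ℕ → ℕ) → Z) : piece f [] = range f := by
  simp [piece]

theorem piece_subset {Z : Type*} (f : (ℕ → ℕ) → Z) (t : List ℕ) :
    piece f t ⊆ ⋃ k : ℕ, piece f (k :: t) := by
  rintro _ ⟨b, hb, rfl⟩
  refine mem_iUnion.2 ⟨b t.length, b, ?_, rfl⟩
  simp only [mem_ofPred_eq] at hb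
  simp [PiNat.res_succ, hb]

theorem isMeagre_frontier {Z : Type*} [TopologicalSpace Z] {U : Set Z} (hU : IsOpen U) :
    IsMeagre (frontier U) := by
  apply IsNowhereDense.isMeagre
  rw [isClosed_frontier.isNowhereDense_iff]
  rw [← frontier_compl]
  exact interior_frontier hU.isClosed_compl

/-- For each set there is an open hull. -/
theorem exists_hull {Z : Type*} [TopologicalSpace Z] [SecondCountableTopology Z] (A : Set Z) :
    ∃ O : Set Z, IsOpen O ∧ IsMeagre (A \ O) ∧
      ∀ W, IsOpen W → W ⊆ O → IsMeagre (A ∩ W) → W = ∅ := by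
  let S : Set (Set Z) := {W | IsOpen W ∧ IsMeagre (A ∩ W)}
  have hSo : ∀ W ∈ S, IsOpen W := fun W h => h.1
  obtain ⟨T, hT, hTS, hTe⟩ := TopologicalSpace.isOpen_sUnion_countable S hSo
  have hUo : IsOpen (⋃₀ S) := isOpen_sUnion hSo
  refine ⟨interior (⋃₀ S)ᶜ, isOpen_interior, ?_, ?_⟩
  · have h1 : IsMeagre (⋃ W ∈ T, A ∩ W) := isMeagre_biUnion hT fun W hW => (hTS hW).2
    refine (h1.union (isMeagre_frontier hUo)).mono ?_
    rintro z ⟨hz, hz'⟩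
    by_cases h : z ∈ ⋃₀ S
    · left
      rw [← hTe] at h
      obtain ⟨W, hW, hzW⟩ := h
      exact mem_biUnion hW ⟨hz, hzW⟩
    · right
      rw [interior_compl, mem_compl_iff, not_not] at hz'
      rw [hUo.frontier_eq]
      exact ⟨hz', h⟩
  · intro W hW hWO hm
    rw [eq_empty_iff_forall_notMem]
    intro z hz
    exact interior_subset (hWO hz) ⟨W, ⟨hW, hm⟩, hz⟩

theorem eq_of_closure {Z : Type*} [TopologicalSpace Z] [T3Space Z]
    {f : (ℕ → ℕ) → Z} (hf : Continuous f) {b : ℕ → ℕ} {z : Z}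
    (h : ∀ n, z ∈ closure (piece f (PiNat.res b n))) : z = f b := by
  by_contra hne
  obtain ⟨V, ⟨hV, hVc⟩, hVz⟩ :=
    (closed_nhds_basis (f b)).mem_iff.1 (isOpen_compl_singleton.mem_nhds (Ne.symm hne) :
      ({z}ᶜ : Set Z) ∈ 𝓝 (f b))
  have h1 : f ⁻¹' V ∈ 𝓝 b := hf.continuousAt hV
  obtain ⟨n, hn⟩ := exists_cyl h1
  have : piece f (PiNat.res b n) ⊆ V := by
    rintro _ ⟨c, hc, rfl⟩
    apply hn
    simp only [mem_ofPred_eq, PiNat.res_length] at hc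
    exact fun i hi => PiNat.res_eq_res.1 hc hi
  exact hVz (closure_minimal this hVc (h n)) rfl

theorem baire_property {Z : Type*} [TopologicalSpace Z] [SecondCountableTopology Z] [T3Space Z]
    {f : (ℕ → ℕ) → Z} (hf : Continuous f) :
    ∃ O : Set Z, IsOpen O ∧ IsMeagre (range f \ O) ∧ IsMeagre (O \ range f) := by
  choose O hO hm hmax using fun t => exists_hull (piece f t)
  refine ⟨O [], hO _, by simpa [piece_nil] using hm [], ?_⟩
  have hcl : ∀ t, O t ⊆ closure (piece f t) := by
    intro t z hz
    by_contra hzc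
    have := hmax t (O t \ closure (piece f t)) ((hO t).sdiff isClosed_closure) sdiff_subset (by
      convert IsMeagre.empty
      rw [eq_empty_iff_forall_notMem]
      rintro w ⟨hw, -, hw'⟩
      exact hw' (subset_closure hw))
    exact (this ▸ (⟨hz, hzc⟩ : z ∈ O t \ closure (piece f t)) : z ∈ (∅ : Set Z))
  have hstep : ∀ t, IsMeagre (O t \ ⋃ k : ℕ, O (k :: t)) := by
    intro t
    have hUo : IsOpen (⋃ k : ℕ, O (k :: t)) := isOpen_iUnion fun k => hO _
    refine (isMeagre_frontier hUo).mono ?_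
    rintro z ⟨hz, hz'⟩
    rw [hUo.frontier_eq]
    refine ⟨?_, hz'⟩
    by_contra hzc
    have := hmax t (O t \ closure (⋃ k : ℕ, O (k :: t))) ((hO t).sdiff isClosed_closure)
      sdiff_subset (by
      refine (isMeagre_iUnion fun k : ℕ => hm (k :: t)).mono ?_
      rintro w ⟨hw, -, hw'⟩
      obtain ⟨k, hk⟩ := mem_iUnion.1 (piece_subset f t hw)
      exact mem_iUnion.2 ⟨k, hk, fun h => hw' (subset_closure (mem_iUnion.2 ⟨k, h⟩))⟩)
    exact (this ▸ (⟨hz, hzc⟩ : z ∈ O t \ closure (⋃ k : ℕ, O (k :: t))) : z ∈ (∅ : Set Z))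
  refine (isMeagre_iUnion hstep).mono ?_
  rintro z ⟨hz, hzr⟩
  by_contra hn
  have hn' : ∀ t, z ∈ O t → ∃ k : ℕ, z ∈ O (k :: t) := by
    intro t ht
    by_contra hc
    refine hn (mem_iUnion.2 ⟨t, ht, ?_⟩)
    simpa using hc
  choose! k hk using hn'
  let T : ℕ → List ℕ := fun n => Nat.rec [] (fun _ t => k t :: t) n
  have hT : ∀ n, z ∈ O (T n) := by
    intro n
    induction n with
    | zero => exact hz
    | succ n ih => exact hk _ ih
  have hres : ∀ n, PiNat.res (fun n => k (T n)) n = T n := by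
    intro n
    induction n with
    | zero => rfl
    | succ n ih => rw [PiNat.res_succ, ih]
  refine hzr ⟨fun n => k (T n), (eq_of_closure hf fun n => ?_).symm⟩
  rw [hres]
  exact hcl _ (hT n)


/-- Flip the `n`-th coordinate. -/
def flip (n : ℕ) (x : ℕ → Bool) : ℕ → Bool := Function.update x n (!x n)

theorem flip_ne {n i : ℕ} (h : i ≠ n) (x : ℕ → Bool) : flip n x i = x i := by
  simp [flip, h]

theorem flip_self (n : ℕ) (x : ℕ → Bool) : flip n x n = !x n := by
  simp [flip]

theorem flip_flip (n : ℕ) (x : ℕ → Bool) : flip n (flip n x) = x := by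
  funext i
  by_cases h : i = n
  · subst h; simp [flip]
  · simp [flip, h]

theorem continuous_flip (n : ℕ) : Continuous (flip n) := by
  refine continuous_pi fun i => ?_
  by_cases h : i = n
  · subst h
    simp only [flip_self]
    exact (continuous_of_discreteTopology (f := fun b : Bool => !b)).comp (continuous_apply i)
  · simp only [flip_ne h]
    exact continuous_apply i

/-- Flipping as a homeomorphism. -/
def flipHomeo (n : ℕ) : (ℕ → Bool) ≃ₜ (ℕ → Bool) where
  toFun := flip n
  invFun := flip n
  left_inv := flip_flip n
  right_inv := flip_flip n
  continuous_toFun := continuous_flip n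
  continuous_invFun := continuous_flip n

theorem meagre_of_flip {Q : Type*} (ψ : (ℕ → Bool) → Q)
    (hA : MeasureTheory.AnalyticSet {z : (ℕ → Bool) × (ℕ → Bool) | ψ z.1 = ψ z.2})
    (hflip : ∀ x n, ψ x ≠ ψ (flip n x)) :
    IsMeagre {z : (ℕ → Bool) × (ℕ → Bool) | ψ z.1 = ψ z.2} := by
  set E := {z : (ℕ → Bool) × (ℕ → Bool) | ψ z.1 = ψ z.2} with hE
  rw [MeasureTheory.AnalyticSet] at hA
  rcases hA with h | ⟨f, hf, hfE⟩
  · rw [h]; exact IsMeagre.empty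
  obtain ⟨O, hO, h1, h2⟩ := baire_property hf
  rw [hfE] at h1 h2
  rcases O.eq_empty_or_nonempty with rfl | ⟨⟨x₀, y₀⟩, h0⟩
  · simpa using h1
  exfalso
  obtain ⟨n, hn⟩ := exists_cyl₂ (hO.mem_nhds h0)
  let h : ((ℕ → Bool) × (ℕ → Bool)) ≃ₜ ((ℕ → Bool) × (ℕ → Bool)) :=
    (Homeomorph.refl _).prodCongr (flipHomeo n)
  have h3 : IsMeagre (h ⁻¹' (O \ E)) :=
    IsMeagre.preimage_of_isOpenMap h.continuous h.isOpenMap h2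
  obtain ⟨z, hz⟩ : ∃ z : (ℕ → Bool) × (ℕ → Bool), z ∈ interior
      ({c : ℕ → Bool | ∀ i < n, c i = x₀ i} ×ˢ {c : ℕ → Bool | ∀ i < n, c i = y₀ i}) \
        ((O \ E) ∪ h ⁻¹' (O \ E)) := by
    by_contra hc
    push Not at hc
    refine not_isMeagre_of_isOpen isOpen_interior
      ⟨(x₀, y₀), mem_interior_iff_mem_nhds.2 (prod_mem_nhds (cyl_mem_nhds x₀ n)
        (cyl_mem_nhds y₀ n))⟩ ((h2.union h3).mono fun z hz => ?_)
    by_contra hz'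
    exact hc z ⟨hz, hz'⟩
  obtain ⟨hzW, hz2⟩ := hz
  obtain ⟨hzx, hzy⟩ := interior_subset hzW
  have hzO : z ∈ O := hn z.1 z.2 hzx hzy
  have hzO' : h z ∈ O := hn z.1 (flip n z.2) hzx fun i hi => by
    rw [flip_ne hi.ne]; exact hzy i hi
  have e1 : z ∈ E := by
    by_contra hne; exact hz2 (Or.inl ⟨hzO, hne⟩)
  have e2 : h z ∈ E := by
    by_contra hne; exact hz2 (Or.inr ⟨hzO', hne⟩)
  have e1' : ψ z.1 = ψ z.2 := e1
  have e2' : ψ z.1 = ψ (flip n z.2) := e2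
  exact hflip z.2 n (e1'.symm.trans e2')

/-- One step of the Mycielski construction. -/
theorem block_step {O : Set ((ℕ → Bool) × (ℕ → Bool))} (hO : IsOpen O) (hd : Dense O) (l : ℕ) :
    ∃ m, l ≤ m ∧ ∃ r r' : ℕ → Bool, ∀ x y : ℕ → Bool,
      (∀ i, l ≤ i → i < m → x i = r i) → (∀ i, l ≤ i → i < m → y i = r' i) → (x, y) ∈ O := by
  have key : ∀ P : Finset ((Fin l → Bool) × (Fin l → Bool)), ∃ m, l ≤ m ∧ ∃ r r' : ℕ → Bool,
      ∀ x y : ℕ → Bool, ((fun i : Fin l => x i), (fun i : Fin l => y i)) ∈ P →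
      (∀ i, l ≤ i → i < m → x i = r i) → (∀ i, l ≤ i → i < m → y i = r' i) → (x, y) ∈ O := by
    intro P
    induction P using Finset.induction_on with
    | empty => exact ⟨l, le_rfl, fun _ => false, fun _ => false, by simp⟩
    | insert p P hp ih =>
      obtain ⟨m, hm, r, r', h⟩ := ih
      let a : ℕ → Bool := fun i => if hi : i < l then p.1 ⟨i, hi⟩ else r i
      let b : ℕ → Bool := fun i => if hi : i < l then p.2 ⟨i, hi⟩ else r' i
      obtain ⟨⟨a', b'⟩, hab, hab'⟩ := mem_closure_iff_nhds.1 (hd (a, b)) _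
        (prod_mem_nhds (cyl_mem_nhds a m) (cyl_mem_nhds b m))
      obtain ⟨ha, hb⟩ := hab
      change ∀ i < m, a' i = a i at ha
      change ∀ i < m, b' i = b i at hb
      obtain ⟨n, hn⟩ := exists_cyl₂ (hO.mem_nhds hab')
      refine ⟨max m n, hm.trans (le_max_left _ _), a', b', fun x y hxy hx hy => ?_⟩
      rw [Finset.mem_insert] at hxy
      rcases hxy with hxy | hxy
      · apply hn
        · intro i hi
          rcases lt_or_ge i l with hil | hil
          · have := congrFun (congrArg Prod.fst hxy) ⟨i, hil⟩
            rw [ha i (hil.trans_le hm)]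
            simp only [a, dif_pos hil]
            exact this
          · exact hx i hil (hi.trans_le (le_max_right _ _))
        · intro i hi
          rcases lt_or_ge i l with hil | hil
          · have := congrFun (congrArg Prod.snd hxy) ⟨i, hil⟩
            rw [hb i (hil.trans_le hm)]
            simp only [b, dif_pos hil]
            exact this
          · exact hy i hil (hi.trans_le (le_max_right _ _))
      · apply h x y hxy
        · intro i hi him
          rw [hx i hi (him.trans_le (le_max_left _ _)), ha i him]
          simp only [a, dif_neg (not_lt.2 hi)]
        · intro i hi him
          rw [hy i hi (him.trans_le (le_max_left _ _)), hb i him]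
          simp only [b, dif_neg (not_lt.2 hi)]
  obtain ⟨m, hm, r, r', h⟩ := key Finset.univ
  exact ⟨m, hm, r, r', fun x y => h x y (Finset.mem_univ _)⟩

theorem mycielski {M : Set ((ℕ → Bool) × (ℕ → Bool))} (hM : IsMeagre M) :
    ∃ χ : (ℕ → Bool) → (ℕ → Bool), ∀ α β, α ≠ β → (χ α, χ β) ∉ M := by
  classical
  rw [IsMeagre, mem_residual_iff] at hM
  obtain ⟨S, hSo, hSd, hSc, hS⟩ := hM
  obtain ⟨O, hO⟩ : ∃ O : ℕ → Set ((ℕ → Bool) × (ℕ → Bool)),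
      (∀ n, IsOpen (O n)) ∧ (∀ n, Dense (O n)) ∧ ⋂ n, O n ⊆ Mᶜ := by
    rcases S.eq_empty_or_nonempty with rfl | hne
    · exact ⟨fun _ => univ, fun _ => isOpen_univ, fun _ => dense_univ, by simpa using hS⟩
    · obtain ⟨O, rfl⟩ := hSc.exists_eq_range hne
      exact ⟨O, fun n => hSo _ ⟨n, rfl⟩, fun n => hSd _ ⟨n, rfl⟩, by simpa [sInter_range] using hS⟩
  obtain ⟨hOo, hOd, hOM⟩ := hO
  let c : ℕ → ℕ × List Bool := fun n => (Encodable.decode (α := ℕ × List Bool) n).getD (0, [])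
  have hc : ∀ p, ∃ n, c n = p := fun p => ⟨Encodable.encode p, by
    simp only [c]; rw [Encodable.encodek]; rfl⟩
  choose m hm r r' hr using fun n l => block_step (hOo (c n).1) (hOd (c n).1) l
  let L : ℕ → ℕ := fun n => Nat.rec 0 (fun n l => m n l) n
  have hL : Monotone L := monotone_nat_of_le_succ fun n => hm n (L n)
  let B : ℕ → ℕ → Prop := fun i n => L n ≤ i ∧ i < L (n + 1)
  have hB : ∀ i n n', B i n → B i n' → n = n' := by
    intro i n n' h h'
    by_contra hne
    rcases lt_or_gt_of_ne hne with hlt | hlt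
    · have := hL (show n + 1 ≤ n' from hlt)
      have := h.2; have := h'.1; omega
    · have := hL (show n' + 1 ≤ n from hlt)
      have := h'.2; have := h.1; omega
  let d : ℕ → ℕ := fun i => Classical.epsilon (B i)
  have hd : ∀ i n, B i n → d i = n := fun i n h =>
    hB i _ _ (Classical.epsilon_spec (p := B i) ⟨n, h⟩) h
  let χ : (ℕ → Bool) → (ℕ → Bool) := fun α i =>
    if PiNat.res α (c (d i)).2.length = (c (d i)).2 then r' (d i) (L (d i)) i
      else r (d i) (L (d i)) i
  have hχ : ∀ α i n, B i n → χ α i =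
      if PiNat.res α (c n).2.length = (c n).2 then r' n (L n) i else r n (L n) i := by
    intro α i n hn
    simp only [χ]
    rw [hd i n hn]
  refine ⟨χ, fun α β hne => ?_⟩
  apply hOM
  rw [mem_iInter]
  intro j
  obtain ⟨k, hk⟩ : ∃ k, PiNat.res α k ≠ PiNat.res β k := by
    by_contra hcon
    push Not at hcon
    exact hne (PiNat.res_injective (funext hcon))
  obtain ⟨n, hn⟩ := hc (j, PiNat.res β k)
  have := hr n (L n) (χ α) (χ β) ?_ ?_
  · rwa [hn] at this
  · intro i h1 h2
    rw [hχ α i n ⟨h1, h2⟩, if_neg]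
    rw [hn]; simpa using hk
  · intro i h1 h2
    rw [hχ β i n ⟨h1, h2⟩, if_pos]
    rw [hn]; simp

open Ordinal Cardinal in
/-- A well-ordered type of cardinality `ℵ₁`. -/
abbrev Om : Type := (Ordinal.omega 1).ToType

/-- Approximations to membership in the range of `f`. -/
def InTree (f : (ℕ → ℕ) → (ℕ → ℕ) × (ℕ → ℕ)) (z : (ℕ → ℕ) × (ℕ → ℕ)) (t : List ℕ) : Prop :=
  ∃ b, PiNat.res b t.length = t ∧ (∀ i < t.length, (f b).1 i = z.1 i) ∧
    ∀ i < t.length, (f b).2 i = z.2 i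

/-- A rank function witnessing that `z` is not in the range of `f`. -/
def Witness (f : (ℕ → ℕ) → (ℕ → ℕ) × (ℕ → ℕ)) (z : (ℕ → ℕ) × (ℕ → ℕ)) (ρ : List ℕ → Om) : Prop :=
  ∀ t k, InTree f z (k :: t) → ρ (k :: t) < ρ t

theorem Witness.notMem {f : (ℕ → ℕ) → (ℕ → ℕ) × (ℕ → ℕ)} {z : (ℕ → ℕ) × (ℕ → ℕ)}
    {ρ : List ℕ → Om} (h : Witness f z ρ) : z ∉ range f := by
  rintro ⟨b, rfl⟩
  have hdesc : ∀ n, ρ (PiNat.res b (n + 1)) < ρ (PiNat.res b n) := by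
    intro n
    rw [PiNat.res_succ]
    refine h _ _ ⟨b, ?_, fun _ _ => rfl, fun _ _ => rfl⟩
    simp [PiNat.res_succ]
  obtain ⟨n, hn⟩ := WellFounded.not_rel_apply_succ (r := ((· < ·) : Om → Om → Prop))
    (fun n => ρ (PiNat.res b n))
  exact hn (hdesc n)

theorem exists_res (t : List ℕ) : ∃ b : ℕ → ℕ, PiNat.res b t.length = t := by
  induction t with
  | nil => exact ⟨fun _ => 0, rfl⟩
  | cons k t ih =>
    obtain ⟨b, hb⟩ := ih
    refine ⟨fun i => if i < t.length then b i else k, ?_⟩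
    rw [List.length_cons, PiNat.res_succ]
    simp only [lt_irrefl, if_false]
    congr 1
    conv_rhs => rw [← hb]
    rw [PiNat.res_eq_res]
    intro i hi
    simp [hi]

theorem exists_witness {f : (ℕ → ℕ) → (ℕ → ℕ) × (ℕ → ℕ)} (hf : Continuous f)
    {z : (ℕ → ℕ) × (ℕ → ℕ)} (hz : z ∉ range f) : ∃ ρ, Witness f z ρ := by
  let r : List ℕ → List ℕ → Prop := fun t' t => ∃ k, t' = k :: t ∧ InTree f z t'
  have hwf : WellFounded r := by
    rw [wellFounded_iff_isEmpty_descending_chain]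
    refine ⟨fun ⟨t, ht⟩ => hz ?_⟩
    choose k hk hin using ht
    obtain ⟨b₀, hb₀⟩ := exists_res (t 0)
    set l := (t 0).length with hl
    let b : ℕ → ℕ := fun i => if i < l then b₀ i else k (i - l)
    have hres : ∀ n, PiNat.res b (l + n) = t n := by
      intro n
      induction n with
      | zero =>
        conv_rhs => rw [← hb₀]
        rw [add_zero, PiNat.res_eq_res]
        intro i hi
        simp [b, hi]
      | succ n ih =>
        rw [← add_assoc, PiNat.res_succ, ih, hk n]
        simp [b]
    refine ⟨b, ?_⟩
    by_contra hne
    have hlim : ∀ n, InTree f z (PiNat.res b (l + n + 1)) := fun n => by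
      have := hin n
      rw [← hres] at this
      exact this
    obtain ⟨n, hn⟩ : ∃ n, ¬ ((∀ i < n, (f b).1 i = z.1 i) ∧ ∀ i < n, (f b).2 i = z.2 i) := by
      by_contra hcon
      push Not at hcon
      exact hne (Prod.ext (funext fun i => (hcon (i + 1)).1 i (Nat.lt_succ_self i))
        (funext fun i => (hcon (i + 1)).2 i (Nat.lt_succ_self i)))
    have hcont : f ⁻¹' ({c : ℕ → ℕ | ∀ i < n, c i = (f b).1 i} ×ˢ
        {c : ℕ → ℕ | ∀ i < n, c i = (f b).2 i}) ∈ 𝓝 b :=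
      hf.continuousAt (prod_mem_nhds (cyl_mem_nhds _ n) (cyl_mem_nhds _ n))
    obtain ⟨m, hm⟩ := exists_cyl hcont
    obtain ⟨c, hc, hc1, hc2⟩ := hlim (m + n)
    rw [PiNat.res_length] at hc hc1 hc2
    obtain ⟨h1, h2⟩ := hm c fun i hi => PiNat.res_eq_res.1 hc (by omega)
    refine hn ⟨fun i hi => ?_, fun i hi => ?_⟩
    · rw [← hc1 i (by omega)]; exact (h1 i hi).symm
    · rw [← hc2 i (by omega)]; exact (h2 i hi).symm
  have : IsWellFounded (List ℕ) r := ⟨hwf⟩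
  have hlt : ∀ t, IsWellFounded.rank r t < Ordinal.omega 1 := by
    intro t
    induction t using hwf.induction with
    | _ t ih =>
      rw [IsWellFounded.rank_eq]
      refine Ordinal.iSup_lt_omega_one fun b => ?_
      exact (Cardinal.isSuccLimit_omega 1).succ_lt (ih b.1 b.2)
  refine ⟨fun t => Ordinal.ToType.mk ⟨IsWellFounded.rank r t, hlt t⟩, fun t k h => ?_⟩
  rw [OrderIso.lt_iff_lt]
  exact IsWellFounded.rank_lt_of_rel (r := r) ⟨k, rfl, h⟩

theorem mk_Om : Cardinal.mk Om = Cardinal.aleph 1 := by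
  simp [Om]

/-- Binary trees of depth `n` with leaves in `Q`. -/
def Tr (Q : Type) : ℕ → Type
  | 0 => Q
  | n + 1 => Tr Q n × Tr Q n

/-- The leaf of a tree at the end of a branch. -/
def ev {Q : Type} : ∀ n, Tr Q n → (ℕ → Bool) → Q
  | 0, a, _ => a
  | n + 1, a, x => if x n then ev n a.2 x else ev n a.1 x

theorem ev_succ {Q : Type} (n : ℕ) (a : Tr Q (n + 1)) (x : ℕ → Bool) :
    ev (n + 1) a x = if x n then ev n a.2 x else ev n a.1 x := rfl

theorem isRegular_two : (Cardinal.aleph 2).IsRegular := by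
  have := Cardinal.isRegular_aleph_add_one 1
  rwa [one_add_one_eq_two] at this

/-- The Fubini powers of the filter of sets with complement of size at most `ℵ₁`. -/
noncomputable def Fil (Q : Type) : ∀ n, Filter (Tr Q n)
  | 0 => Filter.cocardinal Q isRegular_two
  | n + 1 => (Fil Q n).curry (Fil Q n)

theorem fil_forall {Q V : Type} (hV : Cardinal.mk V < Cardinal.aleph 2) (n : ℕ) :
    ∀ (p : Tr Q n → V → Prop), (∀ v, ∀ᶠ a in Fil Q n, p a v) → ∀ᶠ a in Fil Q n, ∀ v, p a v := by
  induction n with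
  | zero =>
    intro p hp
    exact (Filter.eventually_cardinal_forall (c := Cardinal.aleph 2)
      (l := Filter.cocardinal Q isRegular_two) hV).2 hp
  | succ n ih =>
    intro p hp
    refine Filter.eventually_curry_iff.2 ?_
    have h1 : ∀ v, ∀ᶠ a in Fil Q n, ∀ᶠ b in Fil Q n, p (a, b) v := fun v =>
      Filter.eventually_curry_iff.1 (hp v)
    exact (ih _ h1).mono fun a ha => ih _ ha

theorem fil_split {Q V : Type} (hV : Cardinal.mk V < Cardinal.aleph 2) (n : ℕ)
    {P : Tr Q n → Prop} (hP : ∃ᶠ a in Fil Q n, P a) (g : Tr Q n → V) :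
    ∃ v, ∃ᶠ a in Fil Q n, P a ∧ g a = v := by
  by_contra hc
  push Not at hc
  have := fil_forall hV n (fun a v => ¬ (P a ∧ g a = v)) (fun v => by
    simpa [Filter.Frequently] using hc v)
  exact hP (this.mono fun a ha hPa => ha (g a) ⟨hPa, rfl⟩)

theorem fil_avoid {Q : Type} (n : ℕ) (z : Q) : ∀ᶠ a in Fil Q n, ∀ x, ev n a x ≠ z := by
  induction n with
  | zero =>
    exact (Filter.eventually_cocardinal_ne (hreg := isRegular_two) z).mono fun a ha _ => ha
  | succ n ih =>
    refine Filter.eventually_curry_iff.2 ?_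
    refine ih.mono fun a ha => ih.mono fun b hb x => ?_
    change (if x n then ev n b x else ev n a x) ≠ z
    split_ifs
    exacts [hb x, ha x]

theorem ev_congr {Q : Type} (n : ℕ) (a : Tr Q n) {x y : ℕ → Bool} (h : ∀ i < n, x i = y i) :
    ev n a x = ev n a y := by
  induction n with
  | zero => rfl
  | succ n ih =>
    rw [ev_succ, ev_succ, h n (Nat.lt_succ_self n), ih _ fun i hi => h i (hi.trans (Nat.lt_succ_self n)),
      ih _ fun i hi => h i (hi.trans (Nat.lt_succ_self n))]

/-- Extend a finite binary sequence by `false`. -/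
def ext (n : ℕ) (s : Fin n → Bool) : ℕ → Bool := fun i => if h : i < n then s ⟨i, h⟩ else false

theorem ev_ext {Q : Type} (n : ℕ) (a : Tr Q n) (x : ℕ → Bool) :
    ev n a (ext n fun i => x i) = ev n a x :=
  ev_congr n a fun i hi => by simp [ext, hi]

theorem ev_flip_ext {Q : Type} (n : ℕ) (a : Tr Q n) (x : ℕ → Bool) (m : ℕ) :
    ev n a (flip m (ext n fun i => x i)) = ev n a (flip m x) :=
  ev_congr n a fun i hi => by
    by_cases h : i = m
    · subst h; simp [flip_self, ext, hi]
    · simp [flip_ne h, ext, hi]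

theorem fil_step {Q V : Type} (hV : Cardinal.mk V ≤ Cardinal.aleph 1) (W : Q → Q → ℕ → V) (n : ℕ)
    {P : Tr Q n → Prop} (hP : ∃ᶠ a in Fil Q n, P a) :
    ∃ P' : Tr Q (n + 1) → Prop, (∃ᶠ a in Fil Q (n + 1), P' a) ∧
      (∀ a, P' a → P a.1 ∧ P a.2 ∧ ∀ x, ev n a.1 x ≠ ev n a.2 x) ∧
      ∃ v : (ℕ → Bool) → ℕ → ℕ → V, ∀ a, P' a → ∀ x, ∀ m < n + 1, ∀ i < n + 1,
        W (ev (n + 1) a x) (ev (n + 1) a (flip m x)) i = v x m i := by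
  let J := (Fin (n + 1) → Bool) × Fin (n + 1) × Fin (n + 1)
  have h12 : Cardinal.aleph 1 < Cardinal.aleph 2 := Cardinal.aleph_lt_aleph.2 (by norm_num)
  have hcard : Cardinal.mk (J → V) < Cardinal.aleph 2 := by
    refine lt_of_le_of_lt ?_ h12
    rw [Cardinal.mk_pi, Cardinal.prod_const, Cardinal.lift_id, Cardinal.lift_id,
      Cardinal.mk_fintype J]
    refine (Cardinal.power_le_power_right hV).trans ?_
    exact_mod_cast Cardinal.power_nat_le (Cardinal.aleph0_le_aleph 1)
  have h1 : ∃ᶠ a in Fil Q (n + 1), P a.1 ∧ P a.2 ∧ ∀ x, ev n a.1 x ≠ ev n a.2 x := by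
    refine (Filter.frequently_curry_iff _).2 (hP.mono fun a ha => ?_)
    have hav : ∀ᶠ b in Fil Q n, ∀ s : Fin n → Bool, ∀ x, ev n b x ≠ ev n a (ext n s) :=
      Filter.eventually_all.2 fun s => fil_avoid n _
    refine (hP.and_eventually hav).mono fun b hb => ⟨ha, hb.1, fun x hx => ?_⟩
    exact hb.2 (fun i => x i) x (by rw [ev_ext]; exact hx.symm)
  obtain ⟨v, hv⟩ := fil_split hcard (n + 1) h1 (fun a (j : J) =>
    W (ev (n + 1) a (ext (n + 1) j.1)) (ev (n + 1) a (flip j.2.1 (ext (n + 1) j.1))) j.2.2)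
  refine ⟨_, hv, fun a ha => ha.1, fun x m i =>
    v (fun i => x i, Fin.ofNat (n + 1) m, Fin.ofNat (n + 1) i), ?_⟩
  intro a ha x m hm i hi
  rw [← ha.2]
  simp only [Fin.val_ofNat, Nat.mod_eq_of_lt hm, Nat.mod_eq_of_lt hi, ev_ext, ev_flip_ext]

theorem exists_scheme {Q V : Type} (hQ : Cardinal.aleph 2 ≤ Cardinal.mk Q)
    (hV : Cardinal.mk V ≤ Cardinal.aleph 1) (W : Q → Q → ℕ → V) :
    ∃ (v : (ℕ → Bool) → ℕ → ℕ → V) (e : ℕ → (ℕ → Bool) → Q),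
      (∀ n x, ∀ m < n, ∀ i < n, W (e n x) (e n (flip m x)) i = v x m i) ∧
      (∀ n x, ∀ m < n, e n x ≠ e n (flip m x)) ∧
      (∀ x y m i, (∀ j ≤ max m i, x j = y j) → v x m i = v y m i) := by
  have hQ0 : ∃ᶠ a in Fil Q 0, True := by
    rw [Fil]
    refine Filter.frequently_cocardinal.2 ?_
    refine hQ.trans_eq ?_
    exact Cardinal.mk_univ.symm.trans (by congr 1)
  choose! step hs1 hs2 hs3 using fun n (P : Tr Q n → Prop) (hP : ∃ᶠ a in Fil Q n, P a) =>
    fil_step hV W n hP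
  let P : ∀ n, Tr Q n → Prop := fun n => Nat.rec (fun _ => True) (fun n P => step n P) n
  have hP : ∀ n, ∃ᶠ a in Fil Q n, P n a := by
    intro n
    induction n with
    | zero => exact hQ0
    | succ n ih => exact hs1 n _ ih
  choose w hw using fun n => hs3 n (P n) (hP n)
  replace hw : ∀ n a, P (n + 1) a → ∀ x, ∀ m < n + 1, ∀ i < n + 1,
    W (ev (n + 1) a x) (ev (n + 1) a (flip m x)) i = w n x m i := hw
  have hsplit : ∀ n a, P (n + 1) a → P n a.1 ∧ P n a.2 ∧ ∀ x, ev n a.1 x ≠ ev n a.2 x :=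
    fun n => hs2 n (P n) (hP n)
  choose a ha using fun n => (hP n).exists
  have hcoh : ∀ n x m i, m < n + 1 → i < n + 1 → w (n + 1) x m i = w n x m i := by
    intro n x m i hm hi
    rw [← hw (n + 1) (a (n + 2)) (ha (n + 2)) x m (by omega) i (by omega)]
    obtain ⟨h1, h2, -⟩ := hsplit _ _ (ha (n + 2))
    rw [ev_succ (n + 1), ev_succ (n + 1), flip_ne (by omega)]
    split_ifs
    · exact hw n _ h2 x m hm i hi
    · exact hw n _ h1 x m hm i hi
  have hcoh' : ∀ x m i n, max m i ≤ n → w n x m i = w (max m i) x m i := by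
    intro x m i n hn
    induction n, hn using Nat.le_induction with
    | base => rfl
    | succ n hn ih => rw [hcoh n x m i (by omega) (by omega), ih]
  have hne : ∀ n a, P n a → ∀ x, ∀ m < n, ev n a x ≠ ev n a (flip m x) := by
    intro n
    induction n with
    | zero => intro a _ x m hm; omega
    | succ n ih =>
      intro a ha x m hm
      obtain ⟨h1, h2, h3⟩ := hsplit _ _ ha
      rcases Nat.lt_succ_iff_lt_or_eq.1 hm with hm' | rfl
      · rw [ev_succ, ev_succ, flip_ne (by omega)]
        split_ifs
        · exact ih _ h2 x m hm'
        · exact ih _ h1 x m hm'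
      · rw [ev_succ, ev_succ, flip_self]
        have e : ∀ b : Tr Q m, ev m b (flip m x) = ev m b x := fun b =>
          ev_congr m b fun i hi => flip_ne hi.ne x
        rw [e, e]
        cases x m
        · simpa using h3 x
        · simpa using (h3 x).symm
  refine ⟨fun x m i => w (max m i) x m i, fun n => ev n (a n), ?_, fun n x m hm =>
    hne n _ (ha n) x m hm, ?_⟩
  · intro n x m hm i hi
    obtain ⟨n, rfl⟩ : ∃ k, n = k + 1 := ⟨n - 1, by omega⟩
    rw [hw n _ (ha (n + 1)) x m hm i hi]
    exact hcoh' x m i n (by omega)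
  · intro x y m i h
    dsimp only
    set n := max m i
    rw [← hw n _ (ha (n + 1)) x m (by omega) i (by omega), ← hw n _ (ha (n + 1)) y m (by omega) i (by omega)]
    have h' : ∀ j < n + 1, x j = y j := fun j hj => h j (by omega)
    rw [ev_congr (n + 1) _ h', ev_congr (n + 1) _ (x := flip m x) (y := flip m y)]
    intro j hj
    by_cases hjm : j = m
    · subst hjm; rw [flip_self, flip_self, h' j hj]
    · rw [flip_ne hjm, flip_ne hjm, h' j hj]

theorem burgess {Q : Type} (π : (ℕ → ℕ) → Q) (hπ : Function.Surjective π)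
    (hE : MeasureTheory.AnalyticSet {z : (ℕ → ℕ) × (ℕ → ℕ) | π z.1 = π z.2}) :
    Cardinal.mk Q ≤ Cardinal.aleph 1 ∨ Cardinal.mk Q = Cardinal.continuum := by
  by_cases hsmall : Cardinal.mk Q ≤ Cardinal.aleph 1
  · exact Or.inl hsmall
  right
  have hQ : Cardinal.aleph 2 ≤ Cardinal.mk Q := by
    have h := Order.succ_le_of_lt (not_le.1 hsmall)
    rwa [Cardinal.succ_aleph, one_add_one_eq_two] at h
  refine le_antisymm ?_ ?_
  · refine (Cardinal.mk_le_of_surjective hπ).trans ?_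
    simp
  have hE' := hE
  rw [MeasureTheory.AnalyticSet] at hE'
  obtain ⟨f, hf, hfE⟩ : ∃ f : (ℕ → ℕ) → (ℕ → ℕ) × (ℕ → ℕ), Continuous f ∧
      range f = {z : (ℕ → ℕ) × (ℕ → ℕ) | π z.1 = π z.2} := by
    rcases hE' with h | h
    · exfalso
      have : ((fun _ => 0, fun _ => 0) : (ℕ → ℕ) × (ℕ → ℕ)) ∈
        {z : (ℕ → ℕ) × (ℕ → ℕ) | π z.1 = π z.2} := rfl
      rw [h] at this
      exact this
    · exact h
  choose s hs using hπ
  have hex : ∀ q q' : Q, ∃ ρ, q ≠ q' → Witness f (s q, s q') ρ := by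
    intro q q'
    by_cases h : q = q'
    · have : Nonempty Om := by
        rw [← Cardinal.mk_ne_zero_iff, mk_Om]
        exact (Cardinal.aleph_pos 1).ne'
      exact ⟨fun _ => Classical.arbitrary Om, fun h' => absurd h h'⟩
    · obtain ⟨ρ, hρ⟩ := exists_witness hf (z := (s q, s q')) (by
        rw [hfE]
        simpa [hs] using h)
      exact ⟨ρ, fun _ => hρ⟩
  choose ρ hρ using hex
  have hV : Cardinal.mk (ℕ × Om) ≤ Cardinal.aleph 1 := by
    rw [Cardinal.mk_prod, Cardinal.lift_id, Cardinal.lift_id, mk_Om, Cardinal.mk_nat]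
    exact Cardinal.mul_le_of_le (Cardinal.aleph0_le_aleph 1) (Cardinal.aleph0_le_aleph 1) le_rfl
  obtain ⟨v, e, hv, hne, hloc⟩ := exists_scheme hQ hV (fun q q' i =>
    (s q i, ρ q q' ((Encodable.decode (α := List ℕ) i).getD [])))
  let φ : (ℕ → Bool) → (ℕ → ℕ) := fun x i => (v x 0 i).1
  have hφ : ∀ n x, ∀ i < n, s (e n x) i = φ x i := fun n x i hi =>
    congrArg Prod.fst (hv n x 0 (by omega) i hi)
  have hφc : Continuous φ := by
    refine continuous_pi fun i => ?_
    rw [continuous_iff_continuousAt]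
    intro x
    refine ContinuousAt.congr (f := fun _ => φ x i) continuousAt_const ?_
    filter_upwards [cyl_mem_nhds x (i + 1)] with y hy
    simp only [φ]
    rw [hloc x y 0 i fun j hj => (hy j (by simpa [Nat.lt_succ_iff] using hj)).symm]
  have hflip : ∀ x m, π (φ x) ≠ π (φ (flip m x)) := by
    intro x m hcon
    have hw : Witness f (φ x, φ (flip m x)) fun t => (v x m (Encodable.encode t)).2 := by
      intro t k hin
      set n := max m (max (t.length + 1) (max (Encodable.encode t) (Encodable.encode (k :: t)))) + 1
        with hn
      have hval : ∀ u : List ℕ, Encodable.encode u < n →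
          ρ (e n x) (e n (flip m x)) u = (v x m (Encodable.encode u)).2 := by
        intro u hu
        have := congrArg Prod.snd (hv n x m (by omega) _ hu)
        simpa using this
      dsimp only
      rw [← hval t (by omega), ← hval (k :: t) (by omega)]
      refine hρ _ _ (hne n x m (by omega)) t k ?_
      obtain ⟨b, hb, h1, h2⟩ := hin
      simp only [List.length_cons] at hb h1 h2
      refine ⟨b, hb, fun i hi => ?_, fun i hi => ?_⟩
      · simp only [List.length_cons] at hi
        exact (h1 i hi).trans (hφ n x i (by omega)).symm
      · simp only [List.length_cons] at hi
        exact (h2 i hi).trans (hφ n _ i (by omega)).symm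
    apply hw.notMem
    rw [hfE]
    exact hcon
  have : PolishSpace Bool := (Topology.IsClosedEmbedding.of_continuous_injective_isClosedMap
    (f := fun b : Bool => if b then (1 : ℕ) else 0) continuous_of_discreteTopology
    (by intro a b; cases a <;> cases b <;> simp) fun s _ => isClosed_discrete _).polishSpace
  have hm := meagre_of_flip (fun x => π (φ x))
    (hE.preimage (hφc.prodMap hφc)) hflip
  obtain ⟨χ, hχ⟩ := mycielski hm
  have hinj : Function.Injective fun α => π (φ (χ α)) := by
    intro α β h
    by_contra hab
    exact hχ α β hab h
  have := Cardinal.mk_le_of_injective hinj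
  simpa using this

theorem polish_path {X : Type} [TopologicalSpace X] [PolishSpace X] (x : X) :
    PolishSpace (Path x x) := by
  let := TopologicalSpace.upgradeIsCompletelyMetrizable X
  have hP : PolishSpace C(unitInterval, X) := inferInstance
  have hi : Topology.IsInducing (fun p : Path x x => (p : C(unitInterval, X))) := ⟨rfl⟩
  have hinj : Function.Injective (fun p : Path x x => (p : C(unitInterval, X))) := by
    intro p q h
    ext t
    exact congrFun (congrArg DFunLike.coe h) t
  have hr : range (fun p : Path x x => (p : C(unitInterval, X))) =
      {g | g 0 = x} ∩ {g | g 1 = x} := by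
    ext g
    constructor
    · rintro ⟨p, rfl⟩
      exact ⟨p.source, p.target⟩
    · rintro ⟨h0, h1⟩
      exact ⟨⟨g, h0, h1⟩, rfl⟩
  have hc : Topology.IsClosedEmbedding (fun p : Path x x => (p : C(unitInterval, X))) := by
    refine ⟨⟨hi, hinj⟩, ?_⟩
    rw [hr]
    exact (isClosed_eq (continuous_eval_const 0) continuous_const).inter
      (isClosed_eq (continuous_eval_const 1) continuous_const)
  exact hc.polishSpace
end Burgess

/-- If `X` is a path-connected Polish space and `G ≤ π₁(X, x)` is an analytic subgroup,
then the index of `G` in `π₁(X, x)` is either at most `ℵ₁` or equal to `2^ℵ₀`. -/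
theorem index_of_analytic_subgroup {X : Type} [MetricSpace X] [PolishSpace X]
    [PathConnectedSpace X] (x : X) (G : Subgroup (FundamentalGroup X x))
    (hG : MeasureTheory.AnalyticSet (loopsIn G)) :
    Cardinal.mk (FundamentalGroup X x ⧸ G) ≤ Cardinal.aleph 1 ∨
      Cardinal.mk (FundamentalGroup X x ⧸ G) = Cardinal.continuum := by
  have := Burgess.polish_path x
  have : Nonempty (Path x x) := ⟨Path.refl x⟩
  obtain ⟨g, hg, hgs⟩ := PolishSpace.exists_nat_nat_continuous_surjective (Path x x)
  let c : Path x x → FundamentalGroup X x := fun p =>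
    FundamentalGroup.fromPath (X := TopCat.of X) (⟦p⟧ : Path.Homotopic.Quotient x x)
  have hcs : Function.Surjective c := fun γ => Quotient.exists_rep (s := Path.Homotopic.setoid x x) γ
  refine Burgess.burgess (fun b => (QuotientGroup.mk (c (g b)) : FundamentalGroup X x ⧸ G))
    (QuotientGroup.mk_surjective.comp (hcs.comp hgs)) ?_
  have hcont : Continuous fun z : (ℕ → ℕ) × (ℕ → ℕ) => (g z.2).trans (g z.1).symm :=
    Path.continuous_trans.comp ((hg.comp continuous_snd).prodMk
      (Path.continuous_symm.comp (hg.comp continuous_fst)))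
  convert hG.preimage hcont using 1
  ext z
  rw [Set.mem_ofPred_eq, QuotientGroup.eq]
  rfl
end

section
/- Let X be a Polish path-connected space, x ∈ X, and G ≤ π₁(X,x) a coanalytic subgroup (the set of loops representing elements of G is coanalytic in L_x). Then the index of G in π₁(X,x) is either at most ℵ₀ or equal to 2^{ℵ₀}. -/
open FundamentalGroup

attribute [local instance] Path.Homotopic.setoid

open Filter Topology Set in
theorem Silv.exists_lim {A : Type*} [TopologicalSpace A] (t : ℕ → ℕ → A)
    (h : ∀ j i, i < j → t (j + 1) i = t j i) :
    ∃ l : ℕ → A, Tendsto t atTop (𝓝 l) ∧ ∀ j i, i < j → t j i = l i := by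
  have key : ∀ i j, t (i + 1 + j) i = t (i + 1) i := by
    intro i j
    induction j with
    | zero => rfl
    | succ j ih => rw [← ih]; exact h (i + 1 + j) i (by omega)
  have key2 : ∀ j i, i < j → t j i = t (i + 1) i := by
    intro j i hij
    obtain ⟨d, rfl⟩ := Nat.exists_eq_add_of_lt hij
    have := key i d
    rw [← this]; congr 1; omega
  refine ⟨fun i => t (i + 1) i, ?_, key2⟩
  rw [tendsto_pi_nhds]
  intro i
  refine tendsto_const_nhds.congr' ?_
  filter_upwards [eventually_gt_atTop i] with j hj
  exact (key2 j i hj).symm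

/-- Everywhere nonmeagre in the rectangle. -/
def Silv.Pos {Z : Type*} [TopologicalSpace Z] (S : Set (Z × Z)) (U V : Set Z) : Prop :=
  ∀ U' V' : Set Z, IsOpen U' → IsOpen V' → U'.Nonempty → V'.Nonempty → U' ⊆ U → V' ⊆ V →
    ¬ IsMeagre (S ∩ U' ×ˢ V')

theorem Silv.Pos.mono {Z : Type*} [TopologicalSpace Z] {S : Set (Z × Z)} {U V U' V' : Set Z}
    (h : Silv.Pos S U V) (hU : U' ⊆ U) (hV : V' ⊆ V) : Silv.Pos S U' V' :=
  fun A B a b c d e f => h A B a b c d (e.trans hU) (f.trans hV)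

open Filter Topology Set TopologicalSpace in
theorem Silv.pos_split {Z : Type*} [TopologicalSpace Z] [SecondCountableTopology Z]
    (S : ℕ → Set (Z × Z)) (U V : Set Z) (hU : IsOpen U) (hV : IsOpen V) (hU0 : U.Nonempty)
    (hV0 : V.Nonempty) (h : Silv.Pos (⋃ n, S n) U V) :
    ∃ n U' V', IsOpen U' ∧ IsOpen V' ∧ U'.Nonempty ∧ V'.Nonempty ∧ U' ⊆ U ∧ V' ⊆ V ∧
      Silv.Pos (S n) U' V' := by
  by_contra hcon
  push Not at hcon
  refine h U V hU hV hU0 hV0 subset_rfl subset_rfl ?_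
  rw [iUnion_inter]
  refine isMeagre_iUnion fun n => ?_
  let B := countableBasis Z
  have hB := isBasis_countableBasis Z
  have : Countable B := (countable_countableBasis Z).to_subtype
  let I := {P : B × B // IsMeagre (S n ∩ (P.1 : Set Z) ×ˢ (P.2 : Set Z))}
  let W : Set (Z × Z) := ⋃ P : I, (P.1.1 : Set Z) ×ˢ (P.1.2 : Set Z)
  have h1 : IsMeagre (⋃ P : I, S n ∩ (P.1.1 : Set Z) ×ˢ (P.1.2 : Set Z)) :=
    isMeagre_iUnion fun P => P.2
  have h2 : IsNowhereDense ((U ×ˢ V) \ W) := by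
    rw [IsNowhereDense, eq_empty_iff_forall_notMem]
    intro x hx
    obtain ⟨y, hyO, hyU, -⟩ := mem_closure_iff.1 (interior_subset hx) _ isOpen_interior hx
    have hopen : IsOpen (interior (closure ((U ×ˢ V) \ W)) ∩ U ×ˢ V) :=
      isOpen_interior.inter (hU.prod hV)
    obtain ⟨b1, b2, ob1, ob2, y1, y2, hsub⟩ := isOpen_prod_iff.1 hopen y.1 y.2 ⟨hyO, hyU⟩
    have hb1 : b1 ⊆ U := fun a ha => (hsub (mk_mem_prod ha y2)).2.1
    have hb2 : b2 ⊆ V := fun a ha => (hsub (mk_mem_prod y1 ha)).2.2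
    have := hcon n b1 b2 ob1 ob2 ⟨_, y1⟩ ⟨_, y2⟩ hb1 hb2
    unfold Silv.Pos at this
    push Not at this
    obtain ⟨U', V', oU, oV, ⟨u, hu⟩, ⟨v, hv⟩, sU, sV, hm⟩ := this
    obtain ⟨c1, hc1, uc, c1U⟩ := hB.exists_subset_of_mem_open hu oU
    obtain ⟨c2, hc2, vc, c2V⟩ := hB.exists_subset_of_mem_open hv oV
    have hW : c1 ×ˢ c2 ⊆ W := by
      intro p hp
      refine mem_iUnion.2 ⟨⟨(⟨c1, hc1⟩, ⟨c2, hc2⟩), ?_⟩, hp⟩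
      exact hm.mono (inter_subset_inter_right _ (prod_mono c1U c2V))
    have huv : (u, v) ∈ closure ((U ×ˢ V) \ W) :=
      interior_subset (hsub (mk_mem_prod (sU hu) (sV hv))).1
    obtain ⟨w, hw, hw2⟩ := mem_closure_iff.1 huv (c1 ×ˢ c2)
      ((hB.isOpen hc1).prod (hB.isOpen hc2)) ⟨uc, vc⟩
    exact hw2.2 (hW hw)
  refine (h1.union h2.isMeagre).mono ?_
  rintro p ⟨hp, hpU⟩
  by_cases hW : p ∈ W
  · left
    obtain ⟨P, hP⟩ := mem_iUnion.1 hW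
    exact mem_iUnion.2 ⟨P, hp, hP⟩
  · right; exact ⟨hpU, hW⟩

open Set in
theorem Silv.pos_finset {Z : Type*} [TopologicalSpace Z] [SecondCountableTopology Z]
    {α : Type*} [DecidableEq α] (S : α → α → ℕ → Set (Z × Z)) (F : Finset (α × α))
    (O : α → Set Z) (hO : ∀ u, IsOpen (O u) ∧ (O u).Nonempty)
    (hF : ∀ P ∈ F, P.1 ≠ P.2 ∧ Silv.Pos (⋃ n, S P.1 P.2 n) (O P.1) (O P.2)) :
    ∃ O' : α → Set Z, (∀ u, IsOpen (O' u) ∧ (O' u).Nonempty ∧ O' u ⊆ O u) ∧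
      ∀ P ∈ F, ∃ n, Silv.Pos (S P.1 P.2 n) (O' P.1) (O' P.2) := by
  induction F using Finset.induction_on with
  | empty => exact ⟨O, fun u => ⟨(hO u).1, (hO u).2, subset_rfl⟩, by simp⟩
  | insert P F hPF ih =>
    obtain ⟨O', h1, h2⟩ := ih fun P hP => hF P (Finset.mem_insert_of_mem hP)
    obtain ⟨hne, hpos⟩ := hF P (Finset.mem_insert_self _ _)
    obtain ⟨n, U, V, oU, oV, nU, nV, sU, sV, hp⟩ := Silv.pos_split _ (O' P.1) (O' P.2)
      (h1 _).1 (h1 _).1 (h1 _).2.1 (h1 _).2.1 (hpos.mono (h1 _).2.2 (h1 _).2.2)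
    let O2 : α → Set Z := fun u => if u = P.1 then U else if u = P.2 then V else O' u
    have e1 : O2 P.1 = U := by simp [O2]
    have e2 : O2 P.2 = V := by simp [O2, hne.symm]
    have hO2 : ∀ u, IsOpen (O2 u) ∧ (O2 u).Nonempty ∧ O2 u ⊆ O' u := by
      intro u
      by_cases c1 : u = P.1
      · subst c1; rw [e1]; exact ⟨oU, nU, sU⟩
      by_cases c2 : u = P.2
      · subst c2; rw [e2]; exact ⟨oV, nV, sV⟩
      have : O2 u = O' u := by simp [O2, c1, c2]
      rw [this]; exact ⟨(h1 u).1, (h1 u).2.1, subset_rfl⟩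
    refine ⟨O2, fun u => ⟨(hO2 u).1, (hO2 u).2.1, (hO2 u).2.2.trans (h1 u).2.2⟩, ?_⟩
    intro Q hQ
    rcases Finset.mem_insert.1 hQ with rfl | hQ
    · exact ⟨n, by rw [e1, e2]; exact hp⟩
    · obtain ⟨m, hm⟩ := h2 Q hQ
      exact ⟨m, hm.mono (hO2 _).2.2 (hO2 _).2.2⟩

theorem Silv.isOpen_res {A : Type*} [TopologicalSpace A] [DiscreteTopology A] (z : ℕ → A) (n : ℕ) :
    IsOpen {w : ℕ → A | PiNat.res w n = PiNat.res z n} := by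
  have := PiNat.isOpen_cylinder (fun _ => A) z n
  rwa [PiNat.cylinder_eq_res] at this

/-- Stage 2: the perfect set. -/
theorem Silv.stage2 (Φ : (ℕ → Bool) → (ℕ → ℕ)) (hΦ : Continuous Φ)
    (q : (ℕ → ℕ) → (ℕ → ℕ) × (ℕ → ℕ)) (hq : Continuous q)
    (hpos : Silv.Pos {P : (ℕ → Bool) × (ℕ → Bool) | (Φ P.1, Φ P.2) ∈ Set.range q}
      Set.univ Set.univ) :
    ∃ F : (ℕ → Bool) → (ℕ → ℕ), ∀ a b, a ≠ b → (F a, F b) ∈ Set.range q := by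
  classical
  let S : List ℕ → Set ((ℕ → Bool) × (ℕ → Bool)) := fun l =>
    {P | ∃ τ, PiNat.res τ l.length = l ∧ q τ = (Φ P.1, Φ P.2)}
  have hS0 : S [] = {P | (Φ P.1, Φ P.2) ∈ Set.range q} := by
    ext P; simp [S]
  have hS : ∀ l, S l = ⋃ n, S (n :: l) := by
    intro l
    ext P
    simp only [S, Set.mem_ofPred_eq, Set.mem_iUnion, List.length_cons, PiNat.res_succ]
    constructor
    · rintro ⟨τ, h1, h2⟩; exact ⟨τ l.length, τ, by rw [h1], h2⟩
    · rintro ⟨n, τ, h1, h2⟩; exact ⟨τ, (List.cons.inj h1).2, h2⟩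
  let Inv : ℕ → (List Bool → Set (ℕ → Bool)) × (List Bool → List Bool → List ℕ) → Prop :=
    fun n Q => (∀ u, IsOpen (Q.1 u) ∧ (Q.1 u).Nonempty) ∧
      (∀ u, ∀ z ∈ Q.1 u, ∀ w ∈ Q.1 u, PiNat.res z n = PiNat.res w n) ∧
      ∀ u v, u.length = n → v.length = n → u ≠ v → Silv.Pos (S (Q.2 u v)) (Q.1 u) (Q.1 v)
  let Ext : (List Bool → Set (ℕ → Bool)) × (List Bool → List Bool → List ℕ) →
      (List Bool → Set (ℕ → Bool)) × (List Bool → List Bool → List ℕ) → Prop := fun Q Q' =>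
    (∀ b u, Q'.1 (b :: u) ⊆ Q.1 u) ∧
      ∀ b c u v, u ≠ v → ∃ m, Q'.2 (b :: u) (c :: v) = m :: Q.2 u v
  have step : ∀ n Q, Inv n Q → ∃ Q', Inv (n + 1) Q' ∧ Ext Q Q' := by
    rintro n ⟨O, σ⟩ ⟨h1, h2, h3⟩
    -- first shrink
    have hO1 : ∀ u : List Bool, ∃ V : Set (ℕ → Bool), IsOpen V ∧ V.Nonempty ∧ V ⊆ O u.tail ∧
        ∀ z ∈ V, ∀ w ∈ V, PiNat.res z (n + 1) = PiNat.res w (n + 1) := by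
      intro u
      obtain ⟨z, hz⟩ := (h1 u.tail).2
      refine ⟨O u.tail ∩ {w | PiNat.res w (n + 1) = PiNat.res z (n + 1)},
        (h1 u.tail).1.inter (Silv.isOpen_res z (n + 1)), ⟨z, hz, rfl⟩, Set.inter_subset_left, ?_⟩
      rintro a ⟨-, ha⟩ b ⟨-, hb⟩
      exact ha.trans hb.symm
    choose O1 hO1o hO1n hO1s hO1r using hO1
    let σ1 : List Bool → List Bool → List ℕ := fun u v =>
      if u.tail = v.tail then [] else σ u.tail v.tail
    have hfin : {P : List Bool × List Bool |
        P.1.length = n + 1 ∧ P.2.length = n + 1 ∧ P.1 ≠ P.2}.Finite := by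
      refine ((List.finite_length_eq Bool (n + 1)).prod
        (List.finite_length_eq Bool (n + 1))).subset ?_
      rintro P ⟨a, b, -⟩
      exact ⟨a, b⟩
    obtain ⟨O', hO', hF⟩ := Silv.pos_finset (fun u v m => S (m :: σ1 u v)) hfin.toFinset O1
      (fun u => ⟨hO1o u, hO1n u⟩) (by
        rintro ⟨u, v⟩ hP
        rw [Set.Finite.mem_toFinset] at hP
        obtain ⟨hu, hv, huv⟩ := hP
        refine ⟨huv, ?_⟩
        simp only at hu hv huv ⊢
        rw [← hS]
        by_cases ht : u.tail = v.tail
        · simp only [σ1, ht, if_true, hS0]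
          exact hpos.mono (Set.subset_univ _) (Set.subset_univ _)
        · simp only [σ1, ht, if_false]
          exact (h3 u.tail v.tail (by simp [hu]) (by simp [hv]) ht).mono (hO1s u) (hO1s v))
    have hm : ∀ u v : List Bool, ∃ m, u.length = n + 1 → v.length = n + 1 → u ≠ v →
        Silv.Pos (S (m :: σ1 u v)) (O' u) (O' v) := by
      intro u v
      by_cases h : u.length = n + 1 ∧ v.length = n + 1 ∧ u ≠ v
      · obtain ⟨m, hm⟩ := hF (u, v) (by rw [Set.Finite.mem_toFinset]; exact h)
        exact ⟨m, fun _ _ _ => hm⟩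
      · exact ⟨0, fun a b c => (h ⟨a, b, c⟩).elim⟩
    choose m hm using hm
    refine ⟨(O', fun u v => m u v :: σ1 u v), ⟨fun u => ⟨(hO' u).1, (hO' u).2.1⟩, ?_, ?_⟩, ?_, ?_⟩
    · intro u z hz w hw
      exact hO1r u z ((hO' u).2.2 hz) w ((hO' u).2.2 hw)
    · exact hm
    · intro b u
      exact (hO' (b :: u)).2.2.trans (hO1s (b :: u))
    · intro b c u v huv
      exact ⟨m (b :: u) (c :: v), by simp [σ1, huv]⟩
  have h0 : Inv 0 (fun _ => Set.univ, fun _ _ => []) := by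
    refine ⟨fun u => ⟨isOpen_univ, Set.univ_nonempty⟩, fun _ _ _ _ _ => rfl, ?_⟩
    intro u v hu hv huv
    rw [List.length_eq_zero_iff] at hu hv
    exact (huv (hu.trans hv.symm)).elim
  choose! nx hnx1 hnx2 using step
  let Q : ℕ → (List Bool → Set (ℕ → Bool)) × (List Bool → List Bool → List ℕ) :=
    fun n => Nat.rec (fun _ => Set.univ, fun _ _ => []) (fun n Q => nx n Q) n
  have hQ : ∀ n, Inv n (Q n) := by
    intro n
    induction n with
    | zero => exact h0
    | succ n ih => exact hnx1 n _ ih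
  have hE : ∀ n, Ext (Q n) (Q (n + 1)) := fun n => hnx2 n _ (hQ n)
  have hx : ∀ a : ℕ → Bool, ∃ x : ℕ → Bool, ∀ j, ∀ z ∈ (Q j).1 (PiNat.res a j), ∀ i < j,
      z i = x i := by
    intro a
    choose t ht using fun j => ((hQ j).1 (PiNat.res a j)).2
    obtain ⟨l, -, hl⟩ := Silv.exists_lim t (by
      intro j i hij
      have h1 : t (j + 1) ∈ (Q j).1 (PiNat.res a j) := (hE j).1 (a j) _ (ht (j + 1))
      exact PiNat.res_eq_res.1 ((hQ j).2.1 _ _ h1 _ (ht j)) hij)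
    refine ⟨l, fun j z hz i hi => ?_⟩
    rw [← hl j i hi]
    exact PiNat.res_eq_res.1 ((hQ j).2.1 _ _ hz _ (ht j)) hi
  choose x hx using hx
  refine ⟨fun a => Φ (x a), ?_⟩
  intro a b hab
  obtain ⟨k, hk⟩ : ∃ k, a k ≠ b k := by
    by_contra h; push Not at h; exact hab (funext h)
  have hne : ∀ j, PiNat.res a (k + 1 + j) ≠ PiNat.res b (k + 1 + j) := by
    intro j h
    exact hk (PiNat.res_eq_res.1 h (by omega))
  have hnon : ∀ j, ∃ P : (ℕ → Bool) × (ℕ → Bool), ∃ τ,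
      P.1 ∈ (Q (k + 1 + j)).1 (PiNat.res a (k + 1 + j)) ∧
      P.2 ∈ (Q (k + 1 + j)).1 (PiNat.res b (k + 1 + j)) ∧
      PiNat.res τ ((Q (k + 1 + j)).2 (PiNat.res a (k + 1 + j)) (PiNat.res b (k + 1 + j))).length
        = (Q (k + 1 + j)).2 (PiNat.res a (k + 1 + j)) (PiNat.res b (k + 1 + j)) ∧
      q τ = (Φ P.1, Φ P.2) := by
    intro j
    obtain ⟨i1, i2, i3⟩ := hQ (k + 1 + j)
    have := i3 _ _ (PiNat.res_length a (k + 1 + j)) (PiNat.res_length b (k + 1 + j)) (hne j)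
    have := this _ _ (i1 _).1 (i1 _).1 (i1 _).2 (i1 _).2 subset_rfl subset_rfl
    obtain ⟨P, ⟨τ, h1, h2⟩, h3, h4⟩ := nonempty_of_not_isMeagre this
    exact ⟨P, τ, h3, h4, h1, h2⟩
  choose P τ hP1 hP2 hτ hqτ using hnon
  let L : ℕ → List ℕ := fun j =>
    (Q (k + 1 + j)).2 (PiNat.res a (k + 1 + j)) (PiNat.res b (k + 1 + j))
  have hL : ∀ j, ∃ m, L (j + 1) = m :: L j := fun j => (hE (k + 1 + j)).2 _ _ _ _ (hne j)
  have hLlen : ∀ j, j ≤ (L j).length := by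
    intro j
    induction j with
    | zero => exact Nat.zero_le _
    | succ j ih => obtain ⟨m, hm⟩ := hL j; rw [hm, List.length_cons]; omega
  obtain ⟨τ', hτ', -⟩ := Silv.exists_lim τ (by
    intro j i hij
    obtain ⟨m, hm⟩ := hL j
    have e1 : PiNat.res (τ (j + 1)) (L (j + 1)).length = L (j + 1) := hτ (j + 1)
    rw [hm, List.length_cons, PiNat.res_succ] at e1
    have e2 : PiNat.res (τ j) (L j).length = L j := hτ j
    exact PiNat.res_eq_res.1 ((List.cons.inj e1).2.trans e2.symm) (lt_of_lt_of_le hij (hLlen j)))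
  have hconv : ∀ (c : ℕ → Bool) (p : ℕ → (ℕ → Bool)),
      (∀ j, p j ∈ (Q (k + 1 + j)).1 (PiNat.res c (k + 1 + j))) →
      Filter.Tendsto p Filter.atTop (nhds (x c)) := by
    intro c p hp
    rw [tendsto_pi_nhds]
    intro i
    refine tendsto_const_nhds.congr' ?_
    filter_upwards [Filter.eventually_gt_atTop i] with j hj
    exact (hx c _ _ (hp j) i (by omega)).symm
  have c1 := (hΦ.tendsto _).comp (hconv a _ hP1)
  have c2 := (hΦ.tendsto _).comp (hconv b _ hP2)
  have c3 := (hq.tendsto _).comp hτ'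
  have c4 := c1.prodMk_nhds c2
  refine ⟨τ', tendsto_nhds_unique c3 (c4.congr fun j => ?_)⟩
  simp [hqτ]

/-- Finite approximations of the graph `G₀`, on reversed finite sequences. -/
inductive Silv.Edge (s : ℕ → List Bool) : List Bool → List Bool → Prop
  | base (n : ℕ) : Silv.Edge s (false :: s n) (true :: s n)
  | cons (b : Bool) (x y : List Bool) : Silv.Edge s x y → Silv.Edge s (b :: x) (b :: y)

theorem Silv.exists_dense_seq : ∃ s : ℕ → List Bool, (∀ n, (s n).length = n) ∧
    ∀ l : List Bool, ∃ k t, s k = t ++ l := by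
  let d : ℕ → List Bool := fun n => (Encodable.decode (α := List Bool) n.unpair.1).getD []
  refine ⟨fun n => if (d n).length ≤ n then List.replicate (n - (d n).length) false ++ d n
    else List.replicate n false, ?_, ?_⟩
  · intro n
    by_cases h : (d n).length ≤ n
    · simp [h]
    · simp [h]
  · intro l
    have hd : d (Nat.pair (Encodable.encode l) l.length) = l := by simp [d]
    refine ⟨Nat.pair (Encodable.encode l) l.length,
      List.replicate (Nat.pair (Encodable.encode l) l.length - l.length) false, ?_⟩
    simp only [hd]
    rw [if_pos (Nat.right_le_pair _ _)]

/-- Stage 1: a continuous homomorphism from `G₀`. -/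
theorem Silv.stage1 (s : ℕ → List Bool) (hs : ∀ n, (s n).length = n)
    (r : (ℕ → ℕ) → (ℕ → ℕ) → Prop)
    (q : (ℕ → ℕ) → (ℕ → ℕ) × (ℕ → ℕ)) (hq : Continuous q)
    (hr : ∀ x y, ¬ r x y → (x, y) ∈ Set.range q)
    (hunc : ∀ T : Set (ℕ → ℕ), T.Countable → ∃ x, ∀ t ∈ T, ¬ r t x) :
    ∃ Φ : (ℕ → Bool) → (ℕ → ℕ), Continuous Φ ∧ ∀ k z w,
      (∀ j, k ≤ j → z j = w j) →
      (∀ j, Silv.Edge s (PiNat.res z (k + j)) (PiNat.res w (k + j))) →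
        (Φ z, Φ w) ∈ Set.range q := by
  classical
  let Config := (List Bool → (ℕ → ℕ)) × (List Bool → List Bool → (ℕ → ℕ))
  let Valid : ℕ → Config → Prop := fun n γ =>
    ∀ x y, x.length = n → Silv.Edge s x y → q (γ.2 x y) = (γ.1 x, γ.1 y)
  let Good : ℕ → Set Config → Prop := fun n K => ∀ T : Set (ℕ → ℕ), T.Countable →
    ∃ γ ∈ K, Valid n γ ∧ ∀ x, x.length = n → ∀ t ∈ T, ¬ r t (γ.1 x)
  let Agree : ℕ → Set Config → Prop := fun n K => ∀ γ ∈ K, ∀ γ' ∈ K,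
    (∀ x, x.length = n → ∀ i < n, γ.1 x i = γ'.1 x i) ∧
    ∀ x y, x.length = n → y.length = n → ∀ i < n, γ.2 x y i = γ'.2 x y i
  let Merge : Set Config → Config → Prop := fun K γ' => ∃ γ : Bool → Config,
    (∀ b, γ b ∈ K) ∧ (∀ b x, γ'.1 (b :: x) = (γ b).1 x) ∧
      ∀ b x y, γ'.2 (b :: x) (b :: y) = (γ b).2 x y
  have good_split : ∀ n K (ι : Type) (_ : Countable ι) (c : Config → ι), Good n K →
      ∃ i, Good n {γ ∈ K | c γ = i} := by
    intro n K ι _ c hK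
    by_contra hcon
    push Not at hcon
    have : ∀ i, ∃ T : Set (ℕ → ℕ), T.Countable ∧ ∀ γ ∈ K, c γ = i → Valid n γ →
        ∃ x, x.length = n ∧ ∃ t ∈ T, r t (γ.1 x) := by
      intro i
      have h := hcon i
      simp only [Good] at h
      push Not at h
      obtain ⟨T, hT, h⟩ := h
      exact ⟨T, hT, fun γ hγ hc hv => h γ ⟨hγ, hc⟩ hv⟩
    choose T hT h using this
    obtain ⟨γ, hγ, hv, hx⟩ := hK (⋃ i, T i) (Set.countable_iUnion hT)
    obtain ⟨x, hxl, t, ht, hrt⟩ := h (c γ) γ hγ rfl hv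
    exact hx x hxl t (Set.mem_iUnion.2 ⟨_, ht⟩) hrt
  have good_merge : ∀ n K, Good n K → Good (n + 1) {γ | Merge K γ} := by
    intro n K hK T hT
    obtain ⟨γ0, h0, v0, a0⟩ := hK T hT
    obtain ⟨γ1, h1, v1, a1⟩ := hK (insert (γ0.1 (s n)) T) (hT.insert _)
    obtain ⟨w, hw⟩ := hr _ _ (a1 (s n) (hs n) _ (Set.mem_insert _ _))
    let γ : Bool → Config := fun b => if b then γ1 else γ0
    have hγK : ∀ b, γ b ∈ K := by intro b; cases b <;> simp [γ, h0, h1]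
    have hγv : ∀ b, Valid n (γ b) := by
      intro b; cases b
      · exact v0
      · exact v1
    let γ' : Config := (fun l => match l with
      | [] => 0
      | b :: x => (γ b).1 x, fun l l' => match l, l' with
      | b :: x, c :: y => if b = c then (γ b).2 x y else w
      | _, _ => 0)
    refine ⟨γ', ⟨γ, hγK, fun b x => rfl, fun b x y => by simp [γ']⟩, ?_, ?_⟩
    · intro x y hx hE
      cases hE with
      | base m =>
        have : m = n := by simpa [hs] using hx
        subst this
        simp only [γ', γ]
        simpa using hw
      | cons b x y h =>
        have := hγv b x y (by simpa using hx) h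
        simpa [γ'] using this
    · intro x hx t ht
      match x, hx with
      | b :: x, hx =>
        cases b
        · exact a0 x (by simpa using hx) t ht
        · exact a1 x (by simpa using hx) t (Set.mem_insert_of_mem _ ht)
  have step : ∀ n K, Good n K → ∃ K', (Good (n + 1) K' ∧ Agree (n + 1) K') ∧
      ∀ γ ∈ K', Merge K γ := by
    intro n K hK
    let c : Config → (List.Vector Bool (n + 1) → Fin (n + 1) → ℕ) ×
        (List.Vector Bool (n + 1) → List.Vector Bool (n + 1) → Fin (n + 1) → ℕ) := fun γ =>
      (fun x i => γ.1 x.1 i, fun x y i => γ.2 x.1 y.1 i)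
    obtain ⟨i, hi⟩ := good_split (n + 1) _ _ inferInstance c (good_merge n K hK)
    refine ⟨_, ⟨hi, ?_⟩, fun γ hγ => hγ.1⟩
    rintro γ ⟨-, hγ⟩ γ' ⟨-, hγ'⟩
    have e : c γ = c γ' := hγ.trans hγ'.symm
    have e1 := congrArg Prod.fst e
    have e2 := congrArg Prod.snd e
    refine ⟨fun x hx i hi => ?_, fun x y hx hy i hi => ?_⟩
    · exact congrFun (congrFun e1 ⟨x, hx⟩) ⟨i, hi⟩
    · exact congrFun (congrFun (congrFun e2 ⟨x, hx⟩) ⟨y, hy⟩) ⟨i, hi⟩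
  have good0 : Good 0 Set.univ := by
    intro T hT
    obtain ⟨x, hx⟩ := hunc T hT
    refine ⟨(fun _ => x, fun _ _ => x), Set.mem_univ _, ?_, fun _ _ => hx⟩
    intro x y hx hE
    rw [List.length_eq_zero_iff] at hx
    subst hx
    cases hE
  choose! nx hnx1 hnx2 using step
  let K : ℕ → Set Config := fun n => Nat.rec Set.univ (fun n Q => nx n Q) n
  have hK : ∀ n, Good n (K n) ∧ Agree n (K n) := by
    intro n
    induction n with
    | zero => exact ⟨good0, fun _ _ _ _ =>
        ⟨fun _ _ i hi => by omega, fun _ _ _ _ i hi => by omega⟩⟩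
    | succ n ih => exact hnx1 n _ ih.1
  have hM : ∀ n, ∀ γ ∈ K (n + 1), Merge (K n) γ := fun n => hnx2 n _ (hK n).1
  have hch : ∀ n, ∃ γ, γ ∈ K n ∧ Valid n γ := by
    intro n
    obtain ⟨γ, h1, h2, -⟩ := (hK n).1 ∅ Set.countable_empty
    exact ⟨γ, h1, h2⟩
  choose γ hγK hγV using hch
  have coh1 : ∀ (z : ℕ → Bool) j i, i < j →
      (γ (j + 1)).1 (PiNat.res z (j + 1)) i = (γ j).1 (PiNat.res z j) i := by
    intro z j i hij
    obtain ⟨δ, hδ, e1, -⟩ := hM j _ (hγK (j + 1))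
    rw [PiNat.res_succ, e1]
    exact ((hK j).2 _ (hδ _) _ (hγK j)).1 _ (PiNat.res_length z j) i hij
  have hlim := fun z => Silv.exists_lim (fun j => (γ j).1 (PiNat.res z j)) (coh1 z)
  choose Φ hΦt hΦ using hlim
  refine ⟨Φ, ?_, ?_⟩
  · refine continuous_pi fun i => ?_
    refine IsLocallyConstant.continuous ?_
    rw [IsLocallyConstant.iff_eventually_eq]
    intro z
    filter_upwards [(Silv.isOpen_res z (i + 1)).mem_nhds rfl] with w hw
    rw [← hΦ z (i + 1) i (by omega), ← hΦ w (i + 1) i (by omega)]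
    have hw' : PiNat.res w (i + 1) = PiNat.res z (i + 1) := hw
    rw [hw']
  · intro k z w hzw hE
    obtain ⟨τ, hτ, -⟩ := Silv.exists_lim
      (fun j => (γ (k + j)).2 (PiNat.res z (k + j)) (PiNat.res w (k + j))) (by
        intro j i hij
        obtain ⟨δ, hδ, -, e2⟩ := hM (k + j) _ (hγK (k + j + 1))
        show (γ (k + j + 1)).2 (PiNat.res z (k + j + 1)) (PiNat.res w (k + j + 1)) i = _
        rw [PiNat.res_succ, PiNat.res_succ, hzw _ (by omega), e2]
        exact ((hK (k + j)).2 _ (hδ _) _ (hγK (k + j))).2 _ _ (PiNat.res_length _ _)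
          (PiNat.res_length _ _) i (by omega))
    have hadd : Filter.Tendsto (fun j => k + j) Filter.atTop Filter.atTop :=
      Filter.tendsto_atTop_mono (fun j => Nat.le_add_left j k) Filter.tendsto_id
    have c1 := (hΦt z).comp hadd
    have c2 := (hΦt w).comp hadd
    have c3 := (hq.tendsto _).comp hτ
    refine ⟨τ, tendsto_nhds_unique c3 ((c1.prodMk_nhds c2).congr fun j => ?_)⟩
    exact (hγV (k + j) _ _ (PiNat.res_length _ _) (hE j)).symm

/-- Everywhere nonmeagreness. -/
theorem Silv.stage15 (s : ℕ → List Bool) (hs : ∀ n, (s n).length = n)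
    (hd : ∀ l : List Bool, ∃ k t, s k = t ++ l)
    (r : (ℕ → ℕ) → (ℕ → ℕ) → Prop) (heq : Equivalence r)
    (Φ : (ℕ → Bool) → (ℕ → ℕ))
    (h : ∀ k z w, PiNat.res z (k + 1) = false :: s k → PiNat.res w (k + 1) = true :: s k →
      (∀ j, k < j → z j = w j) → ¬ r (Φ z) (Φ w)) :
    Silv.Pos {P : (ℕ → Bool) × (ℕ → Bool) | ¬ r (Φ P.1) (Φ P.2)} Set.univ Set.univ := by
  intro U V oU oV nU nV _ _ hm
  obtain ⟨u, hu⟩ := nU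
  obtain ⟨n, hn⟩ : ∃ n, {w | PiNat.res w n = PiNat.res u n} ⊆ U := by
    obtain ⟨v, ⟨x, n, rfl⟩, h1, h2⟩ :=
      (PiNat.isTopologicalBasis_cylinders (fun _ : ℕ => Bool)).exists_subset_of_mem_open hu oU
    refine ⟨n, ?_⟩
    rw [PiNat.mem_cylinder_iff_eq] at h1
    rw [← h1, PiNat.cylinder_eq_res] at h2
    exact h2
  obtain ⟨k, t, hk⟩ := hd (PiNat.res u n)
  have hlist : ∀ l : List Bool, ∃ z : ℕ → Bool, PiNat.res z l.length = l := by
    intro l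
    induction l with
    | nil => exact ⟨fun _ => false, rfl⟩
    | cons b l ih =>
      obtain ⟨z, hz⟩ := ih
      refine ⟨Function.update z l.length b, ?_⟩
      rw [List.length_cons, PiNat.res_succ, Function.update_self]
      congr 1
      rw [← hz, PiNat.res_length]
      exact PiNat.res_eq_res.2 fun i hi => by simp [hi.ne]
  have hsub : ∀ z : ℕ → Bool, PiNat.res z k = s k → z ∈ U := by
    intro z hz
    apply hn
    show PiNat.res z n = _
    have key : ∀ (t l : List Bool) (z : ℕ → Bool) k, PiNat.res z k = t ++ l →
        PiNat.res z l.length = l := by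
      intro t l z
      induction t with
      | nil => intro k hk; have := congrArg List.length hk; simp at this; rw [← this]; simpa using hk
      | cons b t ih =>
        intro k hk
        cases k with
        | zero => simp at hk
        | succ k => rw [PiNat.res_succ] at hk; exact ih k (List.cons.inj hk).2
    have := key t _ z k (hz.trans hk)
    rwa [PiNat.res_length] at this
  obtain ⟨z0, hz0⟩ := hlist (false :: s k)
  rw [List.length_cons, hs] at hz0
  let f : (ℕ → Bool) → (ℕ → Bool) := fun z => Function.update z k (!(z k))
  have hf : Continuous f := by
    refine continuous_id.update k ?_
    exact (continuous_of_discreteTopology (f := Bool.not)).comp (continuous_apply k)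
  have hff : ∀ z, f (f z) = z := by
    intro z; ext i; by_cases hi : i = k
    · subst hi; simp [f]
    · simp [f, hi]
  let e : (ℕ → Bool) ≃ₜ (ℕ → Bool) := ⟨⟨f, f, hff, hff⟩, hf, hf⟩
  let g := e.prodCongr (Homeomorph.refl (ℕ → Bool))
  have hm2 := hm.preimage_of_isOpenMap g.continuous g.isOpenMap
  have hnot := not_isMeagre_of_isOpen
    ((Silv.isOpen_res z0 (k + 1)).prod oV) (Set.Nonempty.prod ⟨z0, rfl⟩ nV)
  apply hnot
  refine (hm.union hm2).mono ?_
  rintro ⟨z, y⟩ ⟨hz, hy⟩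
  have hz1 : PiNat.res z (k + 1) = false :: s k := hz.trans hz0
  have hz2 := hz1
  rw [PiNat.res_succ] at hz2
  obtain ⟨hzk, hzs⟩ := List.cons.inj hz2
  have hfs : PiNat.res (f z) k = s k := by
    rw [← hzs]; exact PiNat.res_eq_res.2 fun i hi => by simp [f, hi.ne]
  have hfz : PiNat.res (f z) (k + 1) = true :: s k := by
    rw [PiNat.res_succ, hfs]; simp [f, hzk]
  have hnr := h k z (f z) hz1 hfz (fun j hj => by simp [f, hj.ne'])
  by_contra hcon
  rw [Set.mem_union, not_or] at hcon
  obtain ⟨c1, c2⟩ := hcon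
  have d1 : r (Φ z) (Φ y) := by
    by_contra hc; exact c1 ⟨hc, hsub z hzs, hy⟩
  have d2 : r (Φ (f z)) (Φ y) := by
    by_contra hc; exact c2 ⟨hc, hsub (f z) hfs, hy⟩
  exact hnr (heq.trans d1 (heq.symm d2))

theorem Silv.core (r : (ℕ → ℕ) → (ℕ → ℕ) → Prop) (heq : Equivalence r)
    (q : (ℕ → ℕ) → (ℕ → ℕ) × (ℕ → ℕ)) (hq : Continuous q)
    (hr : ∀ x y, ¬ r x y ↔ (x, y) ∈ Set.range q)
    (hunc : ∀ T : Set (ℕ → ℕ), T.Countable → ∃ x, ∀ t ∈ T, ¬ r t x) :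
    ∃ F : (ℕ → Bool) → (ℕ → ℕ), ∀ a b, a ≠ b → ¬ r (F a) (F b) := by
  obtain ⟨s, hs, hd⟩ := Silv.exists_dense_seq
  obtain ⟨Φ, hΦ, hE⟩ := Silv.stage1 s hs r q hq (fun x y => (hr x y).1) hunc
  have hp := Silv.stage15 s hs hd r heq Φ (by
    intro k z w hz hw hzw
    rw [hr]
    refine hE (k + 1) z w ?_ ?_
    · intro j hj; exact hzw j hj
    · intro j
      induction j with
      | zero => rw [Nat.add_zero, hz, hw]; exact Silv.Edge.base k
      | succ j ih =>
        rw [← Nat.add_assoc, PiNat.res_succ, PiNat.res_succ, hzw _ (by omega)]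
        exact Silv.Edge.cons _ _ _ ih)
  simp only [hr] at hp ⊢
  exact Silv.stage2 Φ hΦ q hq hp

/-- Silver's dichotomy (cardinality form). -/
theorem Silv.silver {Y : Type} [TopologicalSpace Y] [PolishSpace Y] (r : Setoid Y)
    (h : MeasureTheory.AnalyticSet {P : Y × Y | ¬ r P.1 P.2}) :
    Cardinal.mk (Quotient r) ≤ Cardinal.aleph0 ∨
      Cardinal.mk (Quotient r) = Cardinal.continuum := by
  by_cases hc : Countable (Quotient r)
  · left; exact Cardinal.mk_le_aleph0
  right
  have hY : Nonempty Y := by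
    by_contra hY
    rw [not_nonempty_iff] at hY
    exact hc inferInstance
  obtain ⟨p, hp, hps⟩ := PolishSpace.exists_nat_nat_continuous_surjective Y
  have hN : Cardinal.mk (ℕ → ℕ) = Cardinal.continuum := by simp
  have hle : Cardinal.mk (Quotient r) ≤ Cardinal.continuum := by
    rw [← hN]
    exact Cardinal.mk_le_of_surjective (f := fun n => Quotient.mk r (p n))
      (Quotient.mk_surjective.comp hps)
  refine le_antisymm hle ?_
  have hunc : ∀ T : Set (ℕ → ℕ), T.Countable → ∃ x, ∀ t ∈ T, ¬ r (p t) (p x) := by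
    intro T hT
    by_contra hcon
    push Not at hcon
    apply hc
    have : Countable T := hT.to_subtype
    refine Function.Surjective.countable (f := fun t : T => Quotient.mk r (p t)) ?_
    intro y
    obtain ⟨y, rfl⟩ := Quotient.exists_rep y
    obtain ⟨x, rfl⟩ := hps y
    obtain ⟨t, ht, hr⟩ := hcon x
    exact ⟨⟨t, ht⟩, Quotient.sound hr⟩
  have h' : MeasureTheory.AnalyticSet {P : (ℕ → ℕ) × (ℕ → ℕ) | ¬ r (p P.1) (p P.2)} :=
    h.preimage (hp.prodMap hp)
  rw [MeasureTheory.AnalyticSet] at h'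
  rcases h' with h' | ⟨q, hq, hqr⟩
  · exfalso
    obtain ⟨x, hx⟩ := hunc {fun _ => 0} (Set.countable_singleton _)
    have : ((fun _ => 0 : ℕ → ℕ), x) ∈ (∅ : Set ((ℕ → ℕ) × (ℕ → ℕ))) := by
      rw [← h']; exact hx _ rfl
    exact this
  · obtain ⟨F, hF⟩ := Silv.core (fun a b => r (p a) (p b))
      ⟨fun _ => r.refl' _, fun h => r.symm' h, fun h h' => r.trans' h h'⟩ q hq
      (fun x y => by rw [hqr]; rfl) hunc
    have hB : Cardinal.mk (ℕ → Bool) = Cardinal.continuum := by simp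
    rw [← hB]
    refine Cardinal.mk_le_of_injective (f := fun a => Quotient.mk r (p (F a))) ?_
    intro a b hab
    by_contra hne
    exact hF a b hne (Quotient.exact hab)

instance Silv.polishPath {X : Type} [TopologicalSpace X] [PolishSpace X] (x : X) :
    PolishSpace (Path x x) := by
  let _ := TopologicalSpace.upgradeIsCompletelyMetrizable X
  have : PolishSpace C(unitInterval, X) := inferInstance
  have : Topology.IsClosedEmbedding (fun p : Path x x => (p : C(unitInterval, X))) := by
    refine ⟨⟨⟨rfl⟩, ?_⟩, ?_⟩
    · intro a b hab
      exact Path.ext (congrArg (fun f : C(unitInterval, X) => (f : unitInterval → X)) hab)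
    · rw [Path.range_coe]
      exact (isClosed_eq (continuous_eval_const _) continuous_const).inter
        (isClosed_eq (continuous_eval_const _) continuous_const)
  exact this.polishSpace

/-- If `X` is a path-connected Polish space and `G ≤ π₁(X, x)` is a coanalytic subgroup,
then the index of `G` in `π₁(X, x)` is either at most `ℵ₀` or equal to `2^ℵ₀`. -/
theorem index_of_coanalytic_subgroup {X : Type} [MetricSpace X] [PolishSpace X]
    [PathConnectedSpace X] (x : X) (G : Subgroup (FundamentalGroup X x))
    (hG : MeasureTheory.AnalyticSet (loopsIn G)ᶜ) :
    Cardinal.mk (FundamentalGroup X x ⧸ G) ≤ Cardinal.aleph0 ∨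
      Cardinal.mk (FundamentalGroup X x ⧸ G) = Cardinal.continuum := by
  let c : Path x x → FundamentalGroup X x := fun p =>
    FundamentalGroup.fromPath (X := TopCat.of X) (⟦p⟧ : Path.Homotopic.Quotient x x)
  have hc : Function.Surjective c := fun g => Quotient.exists_rep g
  let r : Setoid (Path x x) := (QuotientGroup.leftRel G).comap c
  have hmul : ∀ f g : Path x x, c (g.trans f.symm) = (c f)⁻¹ * c g := fun f g => rfl
  have hset : {P : Path x x × Path x x | ¬ r P.1 P.2} =
      (fun P : Path x x × Path x x => P.2.trans P.1.symm) ⁻¹' (loopsIn G)ᶜ := by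
    ext ⟨f, g⟩
    refine not_congr ?_
    show QuotientGroup.leftRel G (c f) (c g) ↔ c (g.trans f.symm) ∈ G
    rw [hmul, QuotientGroup.leftRel_apply]
  have hcont : Continuous (fun P : Path x x × Path x x => P.2.trans P.1.symm) :=
    Path.continuous_trans.comp
      (continuous_snd.prodMk (Path.continuous_symm.comp continuous_fst))
  have hS := Silv.silver r (by rw [hset]; exact hG.preimage hcont)
  have hcard : Cardinal.mk (Quotient r) = Cardinal.mk (FundamentalGroup X x ⧸ G) := by
    refine Cardinal.mk_congr (Equiv.ofBijective
      (Quotient.map' (s₂ := QuotientGroup.leftRel G) c fun a b h => h) ⟨?_, ?_⟩)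
    · intro a b
      obtain ⟨a, rfl⟩ := Quotient.exists_rep a
      obtain ⟨b, rfl⟩ := Quotient.exists_rep b
      intro h
      have h' : Quotient.mk (QuotientGroup.leftRel G) (c a) =
          Quotient.mk (QuotientGroup.leftRel G) (c b) := h
      have h2 : QuotientGroup.leftRel G (c a) (c b) := Quotient.exact h'
      exact Quotient.sound h2
    · intro y
      obtain ⟨g, rfl⟩ := Quotient.exists_rep y
      obtain ⟨p, rfl⟩ := hc g
      exact ⟨Quotient.mk r p, rfl⟩
  rwa [hcard] at hS
end
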